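/- Let l ≥ 2 and let D_l ⊆ PGL₂(ℂ) be the dihedral group of order 2l generated by the class of diag(ζ, ζ⁻¹) (ζ a primitive 2l-th root of unity) and the class of f = [[0, i],[i, 0]]. Let Γ = ℤ/2ℤ act on D_l by entrywise complex conjugation of matrix representatives. Then H¹(Γ, D_l) has exactly 2 elements if l is odd (l ≥ 3), and exactly 4 elements if l is even. -/

import Mathlib

/-- `GL₂(ℂ)`. -/
abbrev GL2C : Type := Matrix.GeneralLinearGroup (Fin 2) ℂ

/-- `PGL₂(ℂ) = GL₂(ℂ)` modulo its center. -/
abbrev PGL2C : Type := GL2C ⧸ Subgroup.center GL2C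

/-- Entrywise complex conjugation on `GL₂(ℂ)`. -/
def glConj : GL2C →* GL2C :=
  Units.map ((starRingEnd ℂ).mapMatrix).toMonoidHom

/-- The first Galois cohomology set `H¹(Γ, A)` of `Γ = Gal(ℂ/ℝ) ≅ ℤ/2ℤ`
acting via `γ` (entrywise complex conjugation) on a subgroup `A ⊆ PGL₂(ℂ)`:
1-cocycles `a ∈ A` with `a ⬝ γ(a) = 1`, modulo `a ∼ b⁻¹ ⬝ a ⬝ γ(b)`, `b ∈ A`. -/
def H1 (γ : PGL2C →* PGL2C) (A : Subgroup PGL2C) : Type :=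
  Quot (fun a₁ a₂ : {a : PGL2C // a ∈ A ∧ a * γ a = 1} =>
    ∃ b ∈ A, a₂.1 = b⁻¹ * a₁.1 * γ b)

/-- `d` and `f` satisfy the dihedral relations (`d` of order `l`, `f ∉ ⟨d⟩`), and the
endomorphism `γ` inverts `d` and fixes `f`. -/
structure IsTwistedDihedral {G : Type*} [Group G] (γ : G →* G) (d f : G) (l : ℕ) : Prop where
  pow_order : d ^ l = 1
  dvd_of_zpow : ∀ k : ℤ, d ^ k = 1 → (l : ℤ) ∣ k
  mul_self : f * f = 1
  semiconj : SemiconjBy f d d⁻¹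
  notMem : f ∉ Subgroup.zpowers d
  map_d : γ d = d⁻¹
  map_f : γ f = f

namespace IsTwistedDihedral

variable {G : Type*} [Group G] {γ : G →* G} {d f : G} {l : ℕ}

theorem f_mul_zpow (h : IsTwistedDihedral γ d f l) (k : ℤ) : f * d ^ k = d ^ (-k) * f := by
  have := (h.semiconj.zpow_right k).eq
  rwa [inv_zpow'] at this

theorem map_zpow (h : IsTwistedDihedral γ d f l) (k : ℤ) : γ (d ^ k) = d ^ (-k) := by
  rw [_root_.map_zpow, h.map_d, inv_zpow']

theorem f_inv (h : IsTwistedDihedral γ d f l) : f⁻¹ = f :=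
  inv_eq_of_mul_eq_one_left h.mul_self

theorem zpow_mul_f_notMem (h : IsTwistedDihedral γ d f l) (k : ℤ) :
    d ^ k * f ∉ Subgroup.zpowers d := fun hk =>
  h.notMem ((Subgroup.mul_mem_cancel_left _ (Subgroup.zpow_mem_zpowers d k)).1 hk)

theorem exists_zpow (h : IsTwistedDihedral γ d f l) {x : G}
    (hx : x ∈ Subgroup.closure {d, f}) : ∃ k : ℤ, x = d ^ k ∨ x = d ^ k * f := by
  induction hx using Subgroup.closure_induction with
  | mem x hx =>
    rcases hx with rfl | rfl
    · exact ⟨1, .inl (zpow_one _).symm⟩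
    · exact ⟨0, .inr (by simp)⟩
  | one => exact ⟨0, .inl (by simp)⟩
  | mul x y _ _ hx hy =>
    obtain ⟨k, rfl | rfl⟩ := hx <;> obtain ⟨m, rfl | rfl⟩ := hy
    · exact ⟨k + m, .inl (zpow_add _ _ _).symm⟩
    · exact ⟨k + m, .inr (by rw [zpow_add, mul_assoc])⟩
    · exact ⟨k - m, .inr (by rw [mul_assoc, h.f_mul_zpow, ← mul_assoc, ← zpow_add, sub_eq_add_neg])⟩
    · refine ⟨k - m, .inl ?_⟩
      rw [mul_assoc, ← mul_assoc f, h.f_mul_zpow, mul_assoc, h.mul_self, mul_one, ← zpow_add,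
        sub_eq_add_neg]
  | inv x _ hx =>
    obtain ⟨k, rfl | rfl⟩ := hx
    · exact ⟨-k, .inl (zpow_neg _ _).symm⟩
    · exact ⟨k, .inr (by rw [mul_inv_rev, h.f_inv, ← zpow_neg, h.f_mul_zpow, neg_neg])⟩

theorem zpow_mul_map (h : IsTwistedDihedral γ d f l) (k : ℤ) : d ^ k * γ (d ^ k) = 1 := by
  rw [h.map_zpow, ← zpow_add, add_neg_cancel, zpow_zero]

theorem zpow_mul_f_mul_map (h : IsTwistedDihedral γ d f l) (k : ℤ) :
    d ^ k * f * γ (d ^ k * f) = d ^ (2 * k) := by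
  rw [map_mul, h.map_zpow, h.map_f, ← mul_assoc, mul_assoc (d ^ k), h.f_mul_zpow, neg_neg,
    ← mul_assoc, ← zpow_add, mul_assoc, h.mul_self, mul_one, two_mul]

/-- Twisted conjugation by a power of `d` on the powers of `d`. -/
theorem twist_zpow_zpow (h : IsTwistedDihedral γ d f l) (j k : ℤ) :
    (d ^ j)⁻¹ * d ^ k * γ (d ^ j) = d ^ (k - 2 * j) := by
  rw [h.map_zpow, ← zpow_neg, ← zpow_add, ← zpow_add]
  congr 1
  ring

theorem exists_twist_zpow (h : IsTwistedDihedral γ d f l) {b : G}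
    (hb : b ∈ Subgroup.closure {d, f}) (k : ℤ) :
    ∃ j : ℤ, b⁻¹ * d ^ k * γ b = d ^ (k - 2 * j) := by
  obtain ⟨j, rfl | rfl⟩ := h.exists_zpow hb
  · exact ⟨j, h.twist_zpow_zpow j k⟩
  · refine ⟨k - j, ?_⟩
    calc (d ^ j * f)⁻¹ * d ^ k * γ (d ^ j * f)
        = f * ((d ^ j)⁻¹ * d ^ k * γ (d ^ j)) * f := by
          rw [map_mul, h.map_f, mul_inv_rev, h.f_inv]; group
      _ = d ^ (k - 2 * (k - j)) := by
          rw [h.twist_zpow_zpow, h.f_mul_zpow, mul_assoc, h.mul_self, mul_one]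
          congr 1
          ring

theorem twist_zpow_mul_f (h : IsTwistedDihedral γ d f l) {b : G}
    (hb : b ∈ Subgroup.closure {d, f}) {k : ℤ} (hk : d ^ (2 * k) = 1) :
    b⁻¹ * (d ^ k * f) * γ b = d ^ k * f := by
  have key : ∀ j : ℤ, (d ^ j)⁻¹ * (d ^ k * f) * γ (d ^ j) = d ^ k * f := fun j => by
    rw [h.map_zpow, mul_assoc, mul_assoc, h.f_mul_zpow, neg_neg, ← zpow_neg, ← mul_assoc,
      ← mul_assoc, ← zpow_add, ← zpow_add]
    congr 2
    ring
  obtain ⟨j, rfl | rfl⟩ := h.exists_zpow hb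
  · exact key j
  · calc (d ^ j * f)⁻¹ * (d ^ k * f) * γ (d ^ j * f)
        = f * ((d ^ j)⁻¹ * (d ^ k * f) * γ (d ^ j)) * f := by
          rw [map_mul, h.map_f, mul_inv_rev, h.f_inv]; group
      _ = d ^ (-k) * f := by
          rw [key, ← mul_assoc, h.f_mul_zpow, mul_assoc, h.mul_self, mul_one]
      _ = d ^ k * f := by
          rw [zpow_neg, inv_eq_of_mul_eq_one_left]
          rw [← zpow_add, ← two_mul, hk]

theorem zpow_eq_zpow (h : IsTwistedDihedral γ d f l) {j k : ℤ} (hjk : (l : ℤ) ∣ j - k) :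
    d ^ j = d ^ k := by
  obtain ⟨m, hm⟩ := hjk
  rw [← mul_inv_eq_one, ← zpow_neg, ← zpow_add, ← sub_eq_add_neg, hm, zpow_mul, zpow_natCast,
    h.pow_order, one_zpow]

theorem dvd_of_zpow_eq (h : IsTwistedDihedral γ d f l) {j k : ℤ} (hjk : d ^ j = d ^ k) :
    (l : ℤ) ∣ j - k := by
  apply h.dvd_of_zpow
  rw [sub_eq_add_neg, zpow_add, zpow_neg, hjk, mul_inv_cancel]

/-- A cocycle is either a power of `d`, or `d ^ k * f` with `d ^ (2 * k) = 1`. -/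
theorem cocycle_cases (h : IsTwistedDihedral γ d f l) {a : G}
    (ha : a ∈ Subgroup.closure {d, f}) (ha' : a * γ a = 1) :
    (∃ k : ℤ, a = d ^ k) ∨ ∃ k : ℤ, a = d ^ k * f ∧ d ^ (2 * k) = 1 := by
  obtain ⟨k, rfl | rfl⟩ := h.exists_zpow ha
  · exact .inl ⟨k, rfl⟩
  · exact .inr ⟨k, rfl, by rw [← h.zpow_mul_f_mul_map, ha']⟩

theorem zpow_mem_closure (d f : G) (k : ℤ) : d ^ k ∈ Subgroup.closure {d, f} :=
  Subgroup.zpow_mem _ (Subgroup.subset_closure (by simp)) k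

theorem zpow_mul_mem_closure (d f : G) (k : ℤ) : d ^ k * f ∈ Subgroup.closure {d, f} :=
  Subgroup.mul_mem _ (zpow_mem_closure d f k) (Subgroup.subset_closure (by simp))

theorem twist_mem_zpowers_iff (h : IsTwistedDihedral γ d f l) {a b : G}
    (ha : a ∈ Subgroup.closure {d, f}) (ha' : a * γ a = 1)
    (hb : b ∈ Subgroup.closure {d, f}) :
    b⁻¹ * a * γ b ∈ Subgroup.zpowers d ↔ a ∈ Subgroup.zpowers d := by
  obtain ⟨k, rfl⟩ | ⟨k, rfl, hk⟩ := h.cocycle_cases ha ha'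
  · obtain ⟨j, hj⟩ := h.exists_twist_zpow hb k
    simp [hj]
  · rw [h.twist_zpow_mul_f hb hk]

theorem zpow_mem_zpowers_sq_iff (h : IsTwistedDihedral γ d f l) (hl : Even l) (k : ℤ) :
    d ^ k ∈ Subgroup.zpowers (d ^ (2 : ℤ)) ↔ Even k := by
  rw [Subgroup.mem_zpowers_iff]
  constructor
  · rintro ⟨m, hm⟩
    rw [← zpow_mul] at hm
    have h2 : (2 : ℤ) ∣ 2 * m - k :=
      (Int.natCast_dvd_natCast.2 hl.two_dvd).trans (h.dvd_of_zpow_eq hm)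
    rw [even_iff_two_dvd]
    omega
  · rintro ⟨m, rfl⟩
    exact ⟨m, by rw [← zpow_mul, two_mul]⟩

theorem zpow_ne_f (h : IsTwistedDihedral γ d f l) (k : ℤ) : d ^ k ≠ f := fun hk =>
  h.notMem (hk ▸ Subgroup.zpow_mem_zpowers d k)

theorem twist_mem_zpowers_sq_iff (h : IsTwistedDihedral γ d f l) (hl : Even l) {a b : G}
    (ha : a ∈ Subgroup.closure {d, f}) (ha' : a * γ a = 1)
    (hb : b ∈ Subgroup.closure {d, f}) :
    (b⁻¹ * a * γ b ∈ Subgroup.zpowers (d ^ (2 : ℤ)) ∨ b⁻¹ * a * γ b = f) ↔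
      (a ∈ Subgroup.zpowers (d ^ (2 : ℤ)) ∨ a = f) := by
  obtain ⟨k, rfl⟩ | ⟨k, rfl, hk⟩ := h.cocycle_cases ha ha'
  · obtain ⟨j, hj⟩ := h.exists_twist_zpow hb k
    simp only [hj, h.zpow_mem_zpowers_sq_iff hl, h.zpow_ne_f, or_false]
    simp [Int.even_sub]
  · rw [h.twist_zpow_mul_f hb hk]

theorem zpow_mul_f_notMem_sq (h : IsTwistedDihedral γ d f l) (k : ℤ) :
    d ^ k * f ∉ Subgroup.zpowers (d ^ (2 : ℤ)) := fun hk =>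
  h.zpow_mul_f_notMem k
    (Subgroup.zpowers_le.2 (Subgroup.zpow_mem_zpowers d 2) hk)

end IsTwistedDihedral

theorem card_H1_of_odd {γ : PGL2C →* PGL2C} {d f : PGL2C} {l : ℕ}
    (h : IsTwistedDihedral γ d f l) (hl : Odd l) :
    Nat.card (H1 γ (Subgroup.closure {d, f})) = 2 := by
  let φ : H1 γ (Subgroup.closure {d, f}) → Prop :=
    Quot.lift (fun a => a.1 ∈ Subgroup.zpowers d) (by
      rintro ⟨a, ha, ha'⟩ ⟨_, _⟩ ⟨b, hb, rfl⟩
      exact propext (h.twist_mem_zpowers_iff ha ha' hb).symm)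
  have hφ : Function.Bijective φ := by
    constructor
    · rintro ⟨a, ha, ha'⟩ ⟨c, hc, hc'⟩ hac
      have hac : a ∈ Subgroup.zpowers d ↔ c ∈ Subgroup.zpowers d := iff_of_eq hac
      apply Quot.sound
      obtain ⟨k, rfl⟩ | ⟨k, rfl, hk⟩ := h.cocycle_cases ha ha' <;>
        obtain ⟨m, rfl⟩ | ⟨m, rfl, hm⟩ := h.cocycle_cases hc hc'
      · obtain ⟨n, rfl⟩ := hl
        refine ⟨d ^ ((n + 1 : ℤ) * (k - m)), IsTwistedDihedral.zpow_mem_closure d f _, ?_⟩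
        rw [h.twist_zpow_zpow]
        refine h.zpow_eq_zpow ⟨k - m, ?_⟩
        push_cast
        ring
      · exact absurd (hac.1 (Subgroup.zpow_mem_zpowers d k)) (h.zpow_mul_f_notMem m)
      · exact absurd (hac.2 (Subgroup.zpow_mem_zpowers d m)) (h.zpow_mul_f_notMem k)
      · refine ⟨1, one_mem _, ?_⟩
        have hcop : IsCoprime (l : ℤ) 2 := by
          exact_mod_cast Nat.isCoprime_iff_coprime.2 hl.coprime_two_right
        have key : ∀ j : ℤ, d ^ (2 * j) = 1 → d ^ j = 1 := fun j hj => by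
          rw [← zpow_zero d]
          exact h.zpow_eq_zpow (by simpa using hcop.dvd_of_dvd_mul_left (h.dvd_of_zpow _ hj))
        simp [key k hk, key m hm]
    · intro p
      by_cases hp : p
      · refine ⟨Quot.mk _ ⟨d ^ (0 : ℤ), IsTwistedDihedral.zpow_mem_closure d f 0,
          h.zpow_mul_map 0⟩, ?_⟩
        exact propext (iff_of_true (Subgroup.zpow_mem_zpowers d 0) hp)
      · refine ⟨Quot.mk _ ⟨d ^ (0 : ℤ) * f, IsTwistedDihedral.zpow_mul_mem_closure d f 0,
          by rw [h.zpow_mul_f_mul_map]; simp⟩, ?_⟩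
        exact propext (iff_of_false (h.zpow_mul_f_notMem 0) hp)
  rw [Nat.card_eq_of_bijective φ hφ]
  simp

theorem card_H1_of_even {γ : PGL2C →* PGL2C} {d f : PGL2C} {l : ℕ}
    (h : IsTwistedDihedral γ d f l) (hl0 : l ≠ 0) (hl : Even l) :
    Nat.card (H1 γ (Subgroup.closure {d, f})) = 4 := by
  let φ : H1 γ (Subgroup.closure {d, f}) → Prop × Prop :=
    Quot.lift (fun a => (a.1 ∈ Subgroup.zpowers d,
      a.1 ∈ Subgroup.zpowers (d ^ (2 : ℤ)) ∨ a.1 = f)) (by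
      rintro ⟨a, ha, ha'⟩ ⟨_, _⟩ ⟨b, hb, rfl⟩
      exact Prod.ext (propext (h.twist_mem_zpowers_iff ha ha' hb).symm)
        (propext (h.twist_mem_zpowers_sq_iff hl ha ha' hb).symm))
  obtain ⟨n, rfl⟩ := hl
  have hn : d ^ (n : ℤ) ≠ 1 := fun hn => by
    have hle := Int.le_of_dvd (by omega) (h.dvd_of_zpow _ hn)
    push_cast at hle
    omega
  have hl : Even (n + n) := ⟨n, rfl⟩
  have hφ : Function.Bijective φ := by
    constructor
    · rintro ⟨a, ha, ha'⟩ ⟨c, hc, hc'⟩ hac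
      obtain ⟨h1, h2⟩ := Prod.ext_iff.1 hac
      have h1 : a ∈ Subgroup.zpowers d ↔ c ∈ Subgroup.zpowers d := iff_of_eq h1
      have h2 : (a ∈ Subgroup.zpowers (d ^ (2 : ℤ)) ∨ a = f) ↔
        (c ∈ Subgroup.zpowers (d ^ (2 : ℤ)) ∨ c = f) := iff_of_eq h2
      apply Quot.sound
      obtain ⟨k, rfl⟩ | ⟨k, rfl, hk⟩ := h.cocycle_cases ha ha' <;>
        obtain ⟨m, rfl⟩ | ⟨m, rfl, hm⟩ := h.cocycle_cases hc hc'
      · simp only [h.zpow_mem_zpowers_sq_iff hl, h.zpow_ne_f, or_false] at h2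
        obtain ⟨j, hj⟩ := Int.even_sub.2 h2
        refine ⟨d ^ j, IsTwistedDihedral.zpow_mem_closure d f _, ?_⟩
        rw [h.twist_zpow_zpow, two_mul, ← hj, sub_sub_cancel]
      · exact absurd (h1.1 (Subgroup.zpow_mem_zpowers d k)) (h.zpow_mul_f_notMem m)
      · exact absurd (h1.2 (Subgroup.zpow_mem_zpowers d m)) (h.zpow_mul_f_notMem k)
      · refine ⟨1, one_mem _, ?_⟩
        simp only [h.zpow_mul_f_notMem_sq, false_or, mul_eq_right] at h2
        have key : ∀ j : ℤ, d ^ (2 * j) = 1 → d ^ j ≠ 1 → d ^ j = d ^ (n : ℤ) := by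
          intro j hj hj1
          obtain ⟨t, ht⟩ := h.dvd_of_zpow _ hj
          have ht' : j = n * t := by
            push_cast at ht
            linarith
          obtain ⟨s, rfl | rfl⟩ := Int.even_or_odd' t
          · refine absurd ?_ hj1
            rw [← zpow_zero d]
            exact h.zpow_eq_zpow ⟨s, by rw [ht']; push_cast; ring⟩
          · exact h.zpow_eq_zpow ⟨s, by rw [ht']; push_cast; ring⟩
        simp only [inv_one, one_mul, map_one, mul_one]
        by_cases hk1 : d ^ k = 1
        · rw [hk1, h2.1 hk1]
        · rw [key k hk hk1, key m hm (mt h2.2 hk1)]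
    · rintro ⟨p, q⟩
      have hf1 : ∀ k : ℤ, d ^ k ∈ Subgroup.zpowers (d ^ (2 : ℤ)) ∨ d ^ k = f ↔ Even k := by
        simp only [h.zpow_mem_zpowers_sq_iff hl, h.zpow_ne_f, or_false, implies_true]
      by_cases hp : p
      · obtain ⟨k, hk⟩ : ∃ k : ℤ, Even k ↔ q := by
          by_cases hq : q
          · exact ⟨0, iff_of_true Even.zero hq⟩
          · exact ⟨1, iff_of_false (by decide) hq⟩
        refine ⟨Quot.mk _ ⟨d ^ k, IsTwistedDihedral.zpow_mem_closure d f k,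
          h.zpow_mul_map k⟩, Prod.ext ?_ ?_⟩
        · exact propext (iff_of_true (Subgroup.zpow_mem_zpowers d k) hp)
        · exact propext ((hf1 k).trans hk)
      · obtain ⟨k, hk, hkq⟩ : ∃ k : ℤ, d ^ (2 * k) = 1 ∧ (d ^ k = 1 ↔ q) := by
          by_cases hq : q
          · exact ⟨0, by simp, iff_of_true (by simp) hq⟩
          · refine ⟨n, ?_, iff_of_false hn hq⟩
            rw [← h.pow_order, two_mul]
            exact_mod_cast rfl
        refine ⟨Quot.mk _ ⟨d ^ k * f, IsTwistedDihedral.zpow_mul_mem_closure d f k,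
          by rw [h.zpow_mul_f_mul_map, hk]⟩, Prod.ext ?_ ?_⟩
        · exact propext (iff_of_false (h.zpow_mul_f_notMem k) hp)
        · have hf2 : d ^ k * f ∈ Subgroup.zpowers (d ^ (2 : ℤ)) ∨ d ^ k * f = f ↔ d ^ k = 1 := by
            simp only [h.zpow_mul_f_notMem_sq, false_or, mul_eq_right]
          exact propext (hf2.trans hkq)
  rw [Nat.card_eq_of_bijective φ hφ]
  simp

theorem neg_one_mem_center_GL2C : (-1 : GL2C) ∈ Subgroup.center GL2C :=
  Subgroup.mem_center_iff.2 fun g => by simp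

theorem coe_zpow_of_diagonal {D : GL2C} {ζ : ℂ} (hζ0 : ζ ≠ 0)
    (hD : (D : Matrix (Fin 2) (Fin 2) ℂ) = Matrix.diagonal ![ζ, ζ⁻¹]) (k : ℤ) :
    ((D ^ k : GL2C) : Matrix (Fin 2) (Fin 2) ℂ) = Matrix.diagonal ![ζ ^ k, ζ⁻¹ ^ k] := by
  have hnat : ∀ n : ℕ, ((D ^ n : GL2C) : Matrix (Fin 2) (Fin 2) ℂ) =
      Matrix.diagonal ![ζ ^ n, ζ⁻¹ ^ n] := fun n => by
    rw [Units.val_pow_eq_pow_val, hD, Matrix.diagonal_pow]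
    congr 1
    ext i
    fin_cases i <;> simp
  obtain ⟨n, rfl | rfl⟩ := k.eq_nat_or_neg
  · simpa using hnat n
  · rw [zpow_neg, zpow_natCast]
    apply Units.inv_eq_of_mul_eq_one_left
    rw [hnat, Matrix.diagonal_mul_diagonal, ← Matrix.diagonal_one]
    congr 1
    ext i
    fin_cases i <;> simp [hζ0]

theorem isTwistedDihedral_PGL2C {l : ℕ} (hl : 2 ≤ l) {ζ : ℂ} (hζ : IsPrimitiveRoot ζ (2 * l))
    {D : GL2C} (hD : (D : Matrix (Fin 2) (Fin 2) ℂ) = Matrix.diagonal ![ζ, ζ⁻¹])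
    {F : GL2C} (hF : (F : Matrix (Fin 2) (Fin 2) ℂ) = !![0, Complex.I; Complex.I, 0])
    {γ : PGL2C →* PGL2C}
    (hγ : ∀ M : GL2C, γ (QuotientGroup.mk M) = QuotientGroup.mk (glConj M)) :
    IsTwistedDihedral γ (QuotientGroup.mk D) (QuotientGroup.mk F) l := by
  have hζ0 : ζ ≠ 0 := hζ.ne_zero (by omega)
  have hDz := coe_zpow_of_diagonal hζ0 hD
  have hDinv : ((D⁻¹ : GL2C) : Matrix (Fin 2) (Fin 2) ℂ) = Matrix.diagonal ![ζ⁻¹, ζ] := by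
    simpa using hDz (-1)
  have hFF : F * F = -1 := by
    ext i j
    rw [Units.val_mul, hF]
    fin_cases i <;> fin_cases j <;> simp
  have hFD : SemiconjBy F D D⁻¹ := by
    ext i j
    rw [Units.val_mul, Units.val_mul, hDinv, hD, hF]
    fin_cases i <;> fin_cases j <;> simp [mul_comm]
  have hD1 : ∀ k : ℤ, D ^ k = 1 → ζ ^ k = 1 := fun k hk => by
    have := congrFun (congrFun (hDz k) 0) 0
    rw [hk] at this
    simpa using this.symm
  have hDl : D ^ l = -1 := by
    have hζl : ζ ^ l = -1 := by
      have h2 : (ζ ^ l) ^ 2 = 1 := by rw [← pow_mul, mul_comm, hζ.pow_eq_one]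
      rcases eq_or_eq_neg_of_sq_eq_sq _ 1 (h2.trans (one_pow 2).symm) with h | h
      · exact absurd (Nat.le_of_dvd (by omega) (hζ.dvd_of_pow_eq_one l h)) (by omega)
      · exact h
    ext i j
    have := hDz l
    rw [zpow_natCast] at this
    rw [this]
    fin_cases i <;> fin_cases j <;> simp [hζl]
  have hconj : (starRingEnd ℂ) ζ = ζ⁻¹ :=
    (Complex.inv_eq_conj (hζ.norm'_eq_one (by omega))).symm
  refine ⟨?_, fun k hk => ?_, ?_, ?_, ?_, ?_, ?_⟩
  · rw [← QuotientGroup.mk_pow, QuotientGroup.eq_one_iff, hDl]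
    exact neg_one_mem_center_GL2C
  · rw [← QuotientGroup.mk_zpow, QuotientGroup.eq_one_iff, Subgroup.mem_center_iff] at hk
    have h1 := (hFD.zpow_right k).eq
    rw [hk F, inv_zpow', mul_left_inj] at h1
    have h2 : D ^ (2 * k) = 1 := by
      rw [two_mul, zpow_add]
      nth_rewrite 1 [h1]
      rw [← zpow_add, neg_add_cancel, zpow_zero]
    have h3 := (hζ.zpow_eq_one_iff_dvd _).1 (hD1 _ h2)
    push_cast at h3
    exact (mul_dvd_mul_iff_left two_ne_zero).1 h3
  · rw [← QuotientGroup.mk_mul, QuotientGroup.eq_one_iff, hFF]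
    exact neg_one_mem_center_GL2C
  · exact congrArg (QuotientGroup.mk (s := Subgroup.center GL2C)) hFD.eq
  · rintro ⟨k, hk⟩
    simp only [← QuotientGroup.mk_zpow] at hk
    rw [QuotientGroup.eq, Subgroup.mem_center_iff] at hk
    have hcomm : Commute D F := by
      have := (Commute.refl D).zpow_right k |>.mul_right (show Commute D ((D ^ k)⁻¹ * F) from hk D)
      rwa [mul_inv_cancel_left] at this
    have h1 := hFD.eq
    rw [← hcomm.eq, mul_left_inj] at h1
    have h2 : D ^ (2 : ℤ) = 1 := by
      rw [zpow_two]
      nth_rewrite 1 [h1]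
      exact inv_mul_cancel D
    have h3 := (hζ.zpow_eq_one_iff_dvd _).1 (hD1 _ h2)
    have := Int.le_of_dvd (by norm_num) h3
    push_cast at this
    omega
  · rw [hγ, ← QuotientGroup.mk_inv]
    congr 1
    ext i j
    rw [hDinv]
    change (starRingEnd ℂ) ((D : Matrix (Fin 2) (Fin 2) ℂ) i j) = _
    rw [hD]
    fin_cases i <;> fin_cases j <;> simp [hconj]
  · have hFneg : glConj F = -F := by
      ext i j
      change (starRingEnd ℂ) ((F : Matrix (Fin 2) (Fin 2) ℂ) i j) =
        -((F : Matrix (Fin 2) (Fin 2) ℂ) i j)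
      rw [hF]
      fin_cases i <;> fin_cases j <;> simp
    rw [hγ, hFneg, eq_comm, QuotientGroup.eq]
    simpa using neg_one_mem_center_GL2C

/-- Let `l ≥ 2` and `D_l ⊆ PGL₂(ℂ)` the dihedral group of
order `2l` generated by the classes of `diag(ζ, ζ⁻¹)` (`ζ` a primitive
`2l`-th root of unity) and of `f = [[0, i], [i, 0]]`. With `Γ = ℤ/2ℤ` acting
by entrywise complex conjugation, `H¹(Γ, D_l)` has exactly 2 elements if `l`
is odd and exactly 4 elements if `l` is even. -/
theorem stmt7 (l : ℕ) (hl : 2 ≤ l) (ζ : ℂ) (hζ : IsPrimitiveRoot ζ (2 * l))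
    (D : GL2C) (hD : (D : Matrix (Fin 2) (Fin 2) ℂ) = Matrix.diagonal ![ζ, ζ⁻¹])
    (F : GL2C)
    (hF : (F : Matrix (Fin 2) (Fin 2) ℂ) = !![0, Complex.I; Complex.I, 0])
    (γ : PGL2C →* PGL2C)
    (hγ : ∀ M : GL2C, γ (QuotientGroup.mk M) = QuotientGroup.mk (glConj M)) :
    (Odd l →
      Nat.card (H1 γ (Subgroup.closure
        {(QuotientGroup.mk D : PGL2C), (QuotientGroup.mk F : PGL2C)})) = 2) ∧
    (Even l →
      Nat.card (H1 γ (Subgroup.closure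
        {(QuotientGroup.mk D : PGL2C), (QuotientGroup.mk F : PGL2C)})) = 4) := by
  have h := isTwistedDihedral_PGL2C hl hζ hD hF hγ
  exact ⟨card_H1_of_odd h, card_H1_of_even h (by omega)⟩
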